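/- In the warden's game with n dice each having m sides (m ≥ 1, n ≥ 1), there exists a sequence w : ZMod (m^n) → Fin m such that for every k ∈ ZMod (m^n), the window W(w, k) equals the unique position x with r̃(x) = ((k̄ + n − 1) mod m^n) + 1, where k̄ ∈ {0,…,m^n−1} is the canonical representative of k; moreover, any such w is an m-ary de Bruijn sequence of rank n, i.e., the map k ↦ W(w, k) is a bijection from ZMod (m^n) onto (Fin m)^n. -/

import Mathlib

/-- One move: the rightmost entry is transferred to the far left, becoming `c`,
producing `(c, x₀, …, x_{n−2})`. -/
def shift {α : Type*} {n : ℕ} (c : α) (x : Fin n → α) : Fin n → α :=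
  fun i => if _h : (i : ℕ) = 0 then c
    else x ⟨(i : ℕ) - 1, lt_of_le_of_lt (Nat.sub_le _ _) i.isLt⟩

/-- The goal position: every die shows `m - 1`. -/
def goalPos (m n : ℕ) (hm : 1 ≤ m) : Fin n → Fin m :=
  fun _ => ⟨m - 1, Nat.sub_lt hm Nat.one_pos⟩

/-- `CanWin m n hm hn N x`: the prisoner can force the goal within `N` moves from
position `x`.  It holds iff `x` is the goal, or `N ≥ 1` and both:
(i) for every warden choice `c < x_{n-1}`, `CanWin (N-1)` holds at `(c, x₀, …, x_{n−2})`, and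
(ii) there is a prisoner choice `c ≥ x_{n-1}` with `CanWin (N-1)` at `(c, x₀, …, x_{n−2})`. -/
def CanWin (m n : ℕ) (hm : 1 ≤ m) (hn : 1 ≤ n) : ℕ → (Fin n → Fin m) → Prop
  | 0, x => x = goalPos m n hm
  | N + 1, x => x = goalPos m n hm ∨
      ((∀ c : Fin m, c < x ⟨n - 1, Nat.sub_lt hn Nat.one_pos⟩ →
          CanWin m n hm hn N (shift c x)) ∧
       ∃ c : Fin m, x ⟨n - 1, Nat.sub_lt hn Nat.one_pos⟩ ≤ c ∧
          CanWin m n hm hn N (shift c x))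

/-- The remoteness of a position: the least `N` with `CanWin N x`. -/
noncomputable def remoteness (m n : ℕ) (hm : 1 ≤ m) (hn : 1 ≤ n)
    (x : Fin n → Fin m) : ℕ :=
  sInf {N | CanWin m n hm hn N x}

/-- `r̃(x)`: equal to the remoteness `r(x)` for `x ≠ g`, and to `m ^ n` for the goal
position `g` (its remoteness treated as a starting position). -/
noncomputable def rTilde (m n : ℕ) (hm : 1 ≤ m) (hn : 1 ≤ n) (x : Fin n → Fin m) : ℕ :=
  if x = goalPos m n hm then m ^ n else remoteness m n hm hn x

/-- The window of length `n` of the cyclic sequence `w` starting at `k`: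
`(w k, w (k+1), …, w (k+n−1))`. -/
def window (m n : ℕ) (w : ZMod (m ^ n) → Fin m) (k : ZMod (m ^ n)) : Fin n → Fin m :=
  fun i => w (k + (i : ℕ))

/-- `w` is an `m`-ary de Bruijn sequence of rank `n`: the map sending `k` to the
window of length `n` starting at `k` is a bijection onto `(Fin m)^n`. -/
def IsDeBruijn (m n : ℕ) (w : ZMod (m ^ n) → Fin m) : Prop :=
  Function.Bijective (window m n w)

section

variable {m n : ℕ}

theorem shift_injective {α : Type*} (hn : 1 ≤ n) {c d : α} {x y : Fin n → α}
    (h : shift c x = shift d y) : c = d := by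
  simpa [shift] using congrFun h ⟨0, hn⟩

theorem apply_eq_of_shift_eq {α : Type*} {c d : α} {x y : Fin n → α}
    (h : shift c x = shift d y) (i : ℕ) (hi : i + 1 < n) :
    x ⟨i, by omega⟩ = y ⟨i, by omega⟩ := by
  simpa [shift] using congrFun h ⟨i + 1, hi⟩

theorem shift_congr {α : Type*} {x y : Fin n → α} (c : α)
    (h : ∀ i (hi : i + 1 < n), x ⟨i, by omega⟩ = y ⟨i, by omega⟩) :
    shift c x = shift c y := by
  funext i
  unfold shift
  split_ifs with h0
  · rfl
  · have := h (i - 1) (by omega)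
    exact this

/-- Every position is a child of a position with any prescribed last entry. -/
theorem exists_eq_shift {α : Type*} (hn : 1 ≤ n) (p : Fin n → α) (a : α) :
    ∃ x : Fin n → α, p = shift (p ⟨0, hn⟩) x ∧ x ⟨n - 1, Nat.sub_lt hn Nat.one_pos⟩ = a ∧
      ∀ i (hi : i + 1 < n), x ⟨i, by omega⟩ = p ⟨i + 1, hi⟩ := by
  refine ⟨fun i => if h : (i : ℕ) + 1 < n then p ⟨i + 1, h⟩ else a, ?_, ?_, ?_⟩
  · funext ⟨i, hi⟩
    unfold shift
    rcases i with _ | i <;> simp [hi]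
  · have : ¬ (n - 1 + 1 < n) := by omega
    simp [this]
  · intro i hi
    simp [hi]

theorem shift_update {α : Type*} (c a : α) (x : Fin n → α) (i : ℕ) (hi : i + 1 < n) :
    shift c (Function.update x ⟨i, by omega⟩ a) =
      Function.update (shift c x) ⟨i + 1, hi⟩ a := by
  funext ⟨j, hj⟩
  rcases j with _ | j
  · simp [shift]
  · simp [shift, Function.update_apply]

/-- If `A` is an initial segment up to possibly the last element, the prisoner wins a one-step
game with target `A` and threshold `y` exactly when `y` is below the size of `A`. -/
theorem forall_lt_and_exists_le_iff_lt_card (A : Finset (Fin m))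
    (hA : ∀ c e : Fin m, c ≤ e → (e : ℕ) + 1 < m → e ∈ A → c ∈ A) (y : Fin m) :
    ((∀ c, c < y → c ∈ A) ∧ ∃ c, y ≤ c ∧ c ∈ A) ↔ (y : ℕ) < A.card := by
  constructor
  · rintro ⟨h1, c, hyc, hc⟩
    have hsub : insert c (Finset.Iio y) ⊆ A := by
      intro d hd
      rcases Finset.mem_insert.1 hd with rfl | hd
      · exact hc
      · exact h1 d (Finset.mem_Iio.1 hd)
    have := Finset.card_le_card hsub
    rw [Finset.card_insert_of_notMem (by simpa using hyc), Fin.card_Iio] at this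
    omega
  · intro h
    constructor
    · intro c hc
      by_contra hcA
      have hsub : A ⊆ insert (⟨m - 1, by omega⟩ : Fin m) (Finset.Iio c) := by
        intro e he
        rw [Finset.mem_insert, Finset.mem_Iio]
        by_contra! hne
        refine hcA (hA c e hne.2 ?_ he)
        have : (e : ℕ) ≠ m - 1 := fun h => hne.1 (Fin.ext h)
        omega
      have h1 := Finset.card_le_card hsub
      have h2 := Finset.card_insert_le (⟨m - 1, by omega⟩ : Fin m) (Finset.Iio c)
      rw [Fin.card_Iio] at h2
      have : (c : ℕ) < y := hc
      omega
    · by_contra! hno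
      have hsub : A ⊆ Finset.Iio y := fun e he =>
        Finset.mem_Iio.2 (not_le.1 fun hye => hno e hye he)
      have := Finset.card_le_card hsub
      rw [Fin.card_Iio] at this
      omega

variable (hm : 1 ≤ m) (hn : 1 ≤ n)

theorem canWin_goalPos (N : ℕ) : CanWin m n hm hn N (goalPos m n hm) := by
  cases N
  · rfl
  · exact Or.inl rfl

theorem canWin_succ {N : ℕ} {x : Fin n → Fin m} (h : CanWin m n hm hn N x) :
    CanWin m n hm hn (N + 1) x := by
  induction N generalizing x with
  | zero => exact Or.inl h
  | succ N ih =>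
    rcases h with h | ⟨h1, c, hc, h2⟩
    · exact Or.inl h
    · exact Or.inr ⟨fun c hc => ih (h1 c hc), c, hc, ih h2⟩

theorem canWin_mono {M N : ℕ} (hMN : M ≤ N) {x : Fin n → Fin m} (h : CanWin m n hm hn M x) :
    CanWin m n hm hn N x :=
  Nat.le_induction h (fun _ _ => canWin_succ hm hn) N hMN

/-- Lowering an entry that is not `m - 1` does not hurt the prisoner. -/
theorem CanWin.update {N : ℕ} {x : Fin n → Fin m} (i : Fin n) (c : Fin m) (hc : c ≤ x i)
    (hi : (x i : ℕ) + 1 < m) (h : CanWin m n hm hn N x) :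
    CanWin m n hm hn N (Function.update x i c) := by
  have hg : x ≠ goalPos m n hm := by
    rintro rfl
    simp only [goalPos] at hi
    omega
  induction N generalizing x i with
  | zero => exact absurd h hg
  | succ N ih =>
    obtain ⟨h1, d, hd, h2⟩ := h.resolve_left hg
    refine Or.inr ?_
    obtain ⟨i, hin⟩ := i
    by_cases hlast : i + 1 < n
    · have hne : (⟨n - 1, Nat.sub_lt hn Nat.one_pos⟩ : Fin n) ≠ ⟨i, hin⟩ := by
        simp only [ne_eq, Fin.mk.injEq]
        omega
      have key : ∀ z, CanWin m n hm hn N (shift z x) →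
          CanWin m n hm hn N (shift z (Function.update x ⟨i, hin⟩ c)) := by
        intro z hz
        have hval : shift z x ⟨i + 1, hlast⟩ = x ⟨i, hin⟩ := by simp [shift]
        rw [shift_update z c x i hlast]
        refine ih ⟨i + 1, hlast⟩ (by rwa [hval]) (by rwa [hval]) hz ?_
        intro hzg
        rw [hzg] at hval
        rw [← hval] at hi
        simp only [goalPos] at hi
        omega
      rw [Function.update_of_ne hne]
      exact ⟨fun z hz => key z (h1 z hz), d, hd, key d h2⟩
    · obtain rfl : i = n - 1 := by omega
      have hshift : ∀ z, shift z (Function.update x ⟨n - 1, hin⟩ c) = shift z x := fun z =>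
        shift_congr z fun j hj =>
          Function.update_of_ne (by simp only [ne_eq, Fin.mk.injEq]; omega) _ _
      simp only [hshift, Function.update_self]
      exact ⟨fun z hz => h1 z (hz.trans_le hc), d, hc.trans hd, h2⟩

/-- The prisoner can force the goal in strictly fewer than `N` moves. -/
def WinsBefore : ℕ → (Fin n → Fin m) → Prop
  | 0, _ => False
  | N + 1, x => CanWin m n hm hn N x

theorem WinsBefore.succ {N : ℕ} {x : Fin n → Fin m} (h : WinsBefore hm hn N x) :
    WinsBefore hm hn (N + 1) x := by
  cases N with
  | zero => exact h.elim
  | succ N => exact canWin_succ hm hn h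

open Classical in
/-- The moves after which the prisoner can force the goal in fewer than `N` further moves. -/
noncomputable def winMoves (N : ℕ) (x : Fin n → Fin m) : Finset (Fin m) :=
  {c | WinsBefore hm hn N (shift c x)}

theorem mem_winMoves {N : ℕ} {x : Fin n → Fin m} {c : Fin m} :
    c ∈ winMoves hm hn N x ↔ WinsBefore hm hn N (shift c x) := by
  simp [winMoves]

theorem winsBefore_succ_iff {N : ℕ} {x : Fin n → Fin m} (hx : x ≠ goalPos m n hm) :
    WinsBefore hm hn (N + 1) x ↔
      (x ⟨n - 1, Nat.sub_lt hn Nat.one_pos⟩ : ℕ) < (winMoves hm hn N x).card := by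
  cases N with
  | zero =>
    have : winMoves hm hn 0 x = ∅ :=
      Finset.eq_empty_of_forall_notMem fun c hc => (mem_winMoves hm hn).1 hc
    simpa [this, WinsBefore, CanWin] using hx
  | succ N =>
    rw [← forall_lt_and_exists_le_iff_lt_card]
    · simp only [mem_winMoves, WinsBefore, CanWin, hx, false_or]
    · intro c e hce he h
      rw [mem_winMoves] at h ⊢
      have h0 : ∀ z : Fin m, shift z x ⟨0, hn⟩ = z := fun z => by simp [shift]
      have := CanWin.update hm hn ⟨0, hn⟩ c (by rwa [h0]) (by rwa [h0]) h
      have hshift : Function.update (shift e x) ⟨0, hn⟩ c = shift c x := by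
        funext ⟨j, hj⟩
        rcases j with _ | j <;> simp [shift]
      rwa [hshift] at this

/-- The prisoner needs exactly `N` moves to force the goal. -/
def WinsIn (N : ℕ) (x : Fin n → Fin m) : Prop :=
  CanWin m n hm hn N x ∧ ¬ WinsBefore hm hn N x

theorem WinsIn.remoteness_eq {N : ℕ} {x : Fin n → Fin m} (h : WinsIn hm hn N x) :
    remoteness m n hm hn x = N := by
  refine IsLeast.csInf_eq ⟨h.1, fun M hM => ?_⟩
  by_contra! hlt
  obtain ⟨K, rfl⟩ : ∃ K, N = K + 1 := ⟨N - 1, by omega⟩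
  exact h.2 (canWin_mono hm hn (by omega) hM)

theorem winsIn_remoteness {N : ℕ} {x : Fin n → Fin m} (h : CanWin m n hm hn N x) :
    WinsIn hm hn (remoteness m n hm hn x) x := by
  refine ⟨Nat.sInf_mem (s := {N | CanWin m n hm hn N x}) ⟨N, h⟩, ?_⟩
  cases hr : remoteness m n hm hn x with
  | zero => exact id
  | succ K =>
    have hK : K < sInf {N | CanWin m n hm hn N x} :=
      (Nat.lt_succ_self K).trans_eq hr.symm
    exact Nat.notMem_of_lt_sInf hK

theorem WinsIn.ne_goalPos {N : ℕ} {x : Fin n → Fin m} (h : WinsIn hm hn (N + 1) x) :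
    x ≠ goalPos m n hm := by
  rintro rfl
  exact h.2 (canWin_goalPos hm hn N)

theorem winMoves_subset_succ (N : ℕ) (x : Fin n → Fin m) :
    winMoves hm hn N x ⊆ winMoves hm hn (N + 1) x := fun c hc => by
  rw [mem_winMoves] at hc ⊢
  exact hc.succ

/-- A position of remoteness `N + 1` has a child of remoteness `N`. -/
theorem WinsIn.exists_shift {N : ℕ} {x : Fin n → Fin m} (h : WinsIn hm hn (N + 1) x) :
    ∃ c, WinsIn hm hn N (shift c x) := by
  have hx := h.ne_goalPos
  have h1 := (winsBefore_succ_iff hm hn (N := N + 1) hx).1 h.1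
  have h2 := mt (winsBefore_succ_iff hm hn hx).2 h.2
  obtain ⟨c, hc, hc'⟩ := Finset.exists_mem_notMem_of_card_lt_card
    (s := winMoves hm hn N x) (t := winMoves hm hn (N + 1) x) (by omega)
  rw [mem_winMoves] at hc hc'
  exact ⟨c, hc, hc'⟩

theorem WinsIn.unique {N : ℕ} {x y : Fin n → Fin m} (hx : WinsIn hm hn N x)
    (hy : WinsIn hm hn N y) : x = y := by
  induction N generalizing x y with
  | zero =>
    have h1 : x = goalPos m n hm := hx.1
    have h2 : y = goalPos m n hm := hy.1
    rw [h1, h2]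
  | succ N ih =>
    obtain ⟨c, hc⟩ := hx.exists_shift
    obtain ⟨d, hd⟩ := hy.exists_shift
    have hcd := ih hc hd
    have hinit := apply_eq_of_shift_eq hcd
    have hmoves : ∀ K, winMoves hm hn K y = winMoves hm hn K x := fun K => by
      ext z
      rw [mem_winMoves, mem_winMoves, shift_congr z hinit]
    have hsub : winMoves hm hn (N + 1) x ⊆ insert c (winMoves hm hn N x) := by
      intro z hz
      rw [Finset.mem_insert]
      by_contra! hne
      rw [mem_winMoves] at hz hne
      exact hne.1 (shift_injective hn (ih ⟨hz, hne.2⟩ hc))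
    have hcard := (Finset.card_le_card hsub).trans (Finset.card_insert_le _ _)
    have hx1 := (winsBefore_succ_iff hm hn (N := N + 1) hx.ne_goalPos).1 hx.1
    have hx2 := mt (winsBefore_succ_iff hm hn hx.ne_goalPos).2 hx.2
    have hy1 := (winsBefore_succ_iff hm hn (N := N + 1) hy.ne_goalPos).1 hy.1
    have hy2 := mt (winsBefore_succ_iff hm hn hy.ne_goalPos).2 hy.2
    rw [hmoves] at hy1 hy2
    funext ⟨i, hi⟩
    by_cases hlast : i + 1 < n
    · exact hinit i hlast
    · obtain rfl : i = n - 1 := by omega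
      apply Fin.ext
      omega

/-- A position of remoteness `N` such that no position has remoteness `N + 1` is a child of the
goal, and then every child of the goal is won by the prisoner. -/
theorem WinsIn.eq_shift_goalPos {N : ℕ} {p : Fin n → Fin m} (hp : WinsIn hm hn N p)
    (hmax : ∀ x, ¬ WinsIn hm hn (N + 1) x) :
    (∃ c, p = shift c (goalPos m n hm)) ∧
      ∀ c, CanWin m n hm hn N (shift c (goalPos m n hm)) := by
  obtain ⟨x₀, hx₀, -, hinit⟩ := exists_eq_shift hn p (p ⟨0, hn⟩)
  set c := p ⟨0, hn⟩
  have hcN : c ∉ winMoves hm hn N x₀ := by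
    rw [mem_winMoves, ← hx₀]
    exact hp.2
  have hcN' : c ∈ winMoves hm hn (N + 1) x₀ := by
    rw [mem_winMoves, ← hx₀]
    exact hp.1
  have hlt : (winMoves hm hn N x₀).card < (winMoves hm hn (N + 1) x₀).card :=
    Finset.card_lt_card ⟨winMoves_subset_succ hm hn N x₀, fun h => hcN (h hcN')⟩
  have hle : (winMoves hm hn (N + 1) x₀).card ≤ m := by
    simpa using Finset.card_le_univ (winMoves hm hn (N + 1) x₀)
  obtain ⟨x, hx, hlast, hinit'⟩ :=
    exists_eq_shift hn p ⟨(winMoves hm hn N x₀).card, hlt.trans_le hle⟩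
  have hmoves : ∀ K, winMoves hm hn K x₀ = winMoves hm hn K x := fun K => by
    ext z
    rw [mem_winMoves, mem_winMoves,
      shift_congr z fun i hi => (hinit i hi).trans (hinit' i hi).symm]
  have hxg : x = goalPos m n hm := by
    by_contra hxg
    refine hmax x ⟨(winsBefore_succ_iff hm hn (N := N + 1) hxg).2 ?_,
      fun h => ?_⟩
    · rw [hlast, ← hmoves]
      exact hlt
    · have := (winsBefore_succ_iff hm hn hxg).1 h
      rw [hlast, ← hmoves] at this
      exact lt_irrefl _ this
  have hval := congrArg Fin.val hlast
  subst hxg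
  refine ⟨⟨_, hx⟩, fun d => ?_⟩
  change m - 1 = (winMoves hm hn N x₀).card at hval
  have huniv : winMoves hm hn (N + 1) (goalPos m n hm) = Finset.univ := by
    rw [← Finset.card_eq_iff_eq_univ, Fintype.card_fin, ← hmoves]
    omega
  have : d ∈ winMoves hm hn (N + 1) (goalPos m n hm) := huniv ▸ Finset.mem_univ d
  exact (mem_winMoves hm hn).1 this

theorem exists_winsIn_max : ∃ N p, WinsIn hm hn N p ∧
    ∀ K, N < K → ∀ x, ¬ WinsIn hm hn K x := by
  classical
  have hg : WinsIn hm hn 0 (goalPos m n hm) := ⟨rfl, id⟩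
  obtain ⟨p, hp, hmax⟩ := Finset.exists_max_image
    (Finset.univ.filter fun x => ∃ N, WinsIn hm hn N x) (remoteness m n hm hn)
    ⟨goalPos m n hm, by simpa using ⟨0, hg⟩⟩
  obtain ⟨N, hN⟩ := (Finset.mem_filter.1 hp).2
  refine ⟨N, p, hN, fun K hK x hx => ?_⟩
  have := hmax x (by simpa using ⟨K, hx⟩)
  rw [hx.remoteness_eq, hN.remoteness_eq] at this
  omega

/-- The prisoner can win from every position. -/
theorem exists_canWin (x : Fin n → Fin m) : ∃ N, CanWin m n hm hn N x := by
  obtain ⟨N, p, hp, hmax⟩ := exists_winsIn_max hm hn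
  have hgoal := (hp.eq_shift_goalPos hm hn (hmax _ (Nat.lt_succ_self N))).2
  suffices ∀ j (x : Fin n → Fin m), (∀ i : Fin n, j ≤ (i : ℕ) → x i = goalPos m n hm i) →
      ∃ N, CanWin m n hm hn N x from this n x fun i hi => absurd i.isLt (by omega)
  intro j
  induction j with
  | zero =>
    intro x hx
    obtain rfl : x = goalPos m n hm := funext fun i => hx i (Nat.zero_le _)
    exact ⟨0, rfl⟩
  | succ j ih =>
    intro x hx
    obtain ⟨y, hxy, hlast, hinit⟩ :=
      exists_eq_shift hn x (goalPos m n hm ⟨n - 1, Nat.sub_lt hn Nat.one_pos⟩)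
    by_cases hy : y = goalPos m n hm
    · rw [hxy, hy]
      exact ⟨N, hgoal _⟩
    · obtain ⟨K, hK⟩ := ih y fun ⟨i, hi⟩ hji => by
        by_cases h : i + 1 < n
        · rw [hinit i h]
          exact hx ⟨i + 1, h⟩ (Nat.succ_le_succ hji)
        · obtain rfl : i = n - 1 := by omega
          exact hlast
      have hcard := (winsBefore_succ_iff hm hn (N := K) hy).1 hK
      rw [hlast] at hcard
      simp only [goalPos] at hcard
      have huniv : winMoves hm hn K y = Finset.univ := by
        rw [← Finset.card_eq_iff_eq_univ, Fintype.card_fin]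
        have := Finset.card_le_univ (winMoves hm hn K y)
        rw [Fintype.card_fin] at this
        omega
      have hmem : x ⟨0, hn⟩ ∈ winMoves hm hn K y := huniv ▸ Finset.mem_univ _
      rw [mem_winMoves, ← hxy] at hmem
      exact ⟨K, WinsBefore.succ hm hn hmem⟩

theorem winsIn_iff {N : ℕ} {x : Fin n → Fin m} :
    WinsIn hm hn N x ↔ remoteness m n hm hn x = N := by
  refine ⟨fun h => h.remoteness_eq, ?_⟩
  rintro rfl
  obtain ⟨N, hN⟩ := exists_canWin hm hn x
  exact winsIn_remoteness hm hn hN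

theorem remoteness_injective : Function.Injective (remoteness m n hm hn) := fun _ _ h =>
  ((winsIn_iff hm hn).2 h).unique hm hn ((winsIn_iff hm hn).2 rfl)

theorem remoteness_eq_zero_iff {x : Fin n → Fin m} :
    remoteness m n hm hn x = 0 ↔ x = goalPos m n hm := by
  rw [← winsIn_iff]
  exact ⟨fun h => h.1, fun h => ⟨h, id⟩⟩

theorem exists_remoteness_eq_of_le (x : Fin n → Fin m) {N : ℕ}
    (hN : N ≤ remoteness m n hm hn x) : ∃ y, remoteness m n hm hn y = N := by
  induction hN using Nat.decreasingInduction with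
  | self => exact ⟨x, rfl⟩
  | of_succ N hN ih =>
    obtain ⟨y, hy⟩ := ih
    obtain ⟨c, hc⟩ := ((winsIn_iff hm hn).2 hy).exists_shift
    exact ⟨_, hc.remoteness_eq⟩

theorem remoteness_lt (x : Fin n → Fin m) : remoteness m n hm hn x < m ^ n := by
  have hsub : Finset.range (remoteness m n hm hn x + 1) ⊆
      Finset.univ.image (remoteness m n hm hn) := fun N hN => by
    obtain ⟨y, hy⟩ := exists_remoteness_eq_of_le hm hn x
      (Nat.lt_succ_iff.1 (Finset.mem_range.1 hN))
    exact Finset.mem_image.2 ⟨y, Finset.mem_univ _, hy⟩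
  have := (Finset.card_le_card hsub).trans Finset.card_image_le
  simpa [Nat.succ_le_iff] using this

theorem remoteness_cast_bijective :
    Function.Bijective fun x => (remoteness m n hm hn x : ZMod (m ^ n)) := by
  have : NeZero (m ^ n) := ⟨(pow_pos hm n).ne'⟩
  rw [Fintype.bijective_iff_injective_and_card]
  refine ⟨fun x y h => remoteness_injective hm hn ?_, by simp [ZMod.card]⟩
  have h' := (ZMod.natCast_eq_natCast_iff' _ _ _).1 h
  rwa [Nat.mod_eq_of_lt (remoteness_lt hm hn x), Nat.mod_eq_of_lt (remoteness_lt hm hn y)] at h'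

/-- The cyclic order by remoteness steps through children; in particular the position of the
largest remoteness is a child of the goal. -/
theorem exists_remoteness_shift_add_one (x : Fin n → Fin m) :
    ∃ c, (remoteness m n hm hn (shift c x) : ZMod (m ^ n)) + 1 = remoteness m n hm hn x := by
  cases hr : remoteness m n hm hn x with
  | succ N =>
    obtain ⟨c, hc⟩ := ((winsIn_iff hm hn).2 hr).exists_shift
    exact ⟨c, by simp [hc.remoteness_eq]⟩
  | zero =>
    rw [remoteness_eq_zero_iff] at hr
    subst hr
    have hpos : 0 < m ^ n := pow_pos hm n
    obtain ⟨p, hp⟩ := (remoteness_cast_bijective hm hn).2 ((m ^ n - 1 : ℕ) : ZMod (m ^ n))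
    have hp' := (ZMod.natCast_eq_natCast_iff' _ _ _).1 hp
    rw [Nat.mod_eq_of_lt (remoteness_lt hm hn p), Nat.mod_eq_of_lt (by omega)] at hp'
    obtain ⟨⟨c, rfl⟩, -⟩ := ((winsIn_iff hm hn).2 hp').eq_shift_goalPos hm hn fun x hx => by
      have h1 := hx.remoteness_eq
      have h2 := remoteness_lt hm hn x
      omega
    refine ⟨c, ?_⟩
    rw [hp', ← Nat.cast_add_one, Nat.sub_add_cancel hpos, ZMod.natCast_self, Nat.cast_zero]

theorem rTilde_eq_iff (k : ZMod (m ^ n)) (x : Fin n → Fin m) :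
    rTilde m n hm hn x = (k.val + n - 1) % m ^ n + 1 ↔
      (remoteness m n hm hn x : ZMod (m ^ n)) = k + n := by
  have : NeZero (m ^ n) := ⟨(pow_pos hm n).ne'⟩
  have hlt := remoteness_lt hm hn x
  have hzero := remoteness_eq_zero_iff hm hn (x := x)
  have hk : k + n = ((k.val + n - 1 + 1 : ℕ) : ZMod (m ^ n)) := by
    rw [Nat.sub_add_cancel (by omega), Nat.cast_add, ZMod.natCast_zmod_val]
  rw [hk, ZMod.natCast_eq_natCast_iff', Nat.mod_eq_of_lt hlt]
  generalize k.val + n - 1 = t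
  have hmod : (t + 1) % m ^ n = if t % m ^ n + 1 = m ^ n then 0 else t % m ^ n + 1 := by
    have ht := Nat.mod_lt t (pow_pos hm n)
    rw [← Nat.mod_add_mod]
    split_ifs with h
    · rw [h, Nat.mod_self]
    · exact Nat.mod_eq_of_lt (by omega)
  rw [hmod, rTilde]
  split_ifs <;> simp_all <;> omega

end

/-- There is a sequence `w : ZMod (m^n) → Fin m` such that for every `k`, the window
`W(w, k)` is the unique position `x` with `r̃(x) = ((k̄ + n − 1) mod m^n) + 1`;
moreover, any such `w` is an `m`-ary de Bruijn sequence of rank `n`. -/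
theorem warden_deBruijn (m n : ℕ) (hm : 1 ≤ m) (hn : 1 ≤ n) :
    (∃ w : ZMod (m ^ n) → Fin m, ∀ k : ZMod (m ^ n), ∀ x : Fin n → Fin m,
        window m n w k = x ↔ rTilde m n hm hn x = (k.val + n - 1) % m ^ n + 1) ∧
    (∀ w : ZMod (m ^ n) → Fin m,
        (∀ k : ZMod (m ^ n), ∀ x : Fin n → Fin m,
          window m n w k = x ↔ rTilde m n hm hn x = (k.val + n - 1) % m ^ n + 1) →
        IsDeBruijn m n w) := by
  simp only [rTilde_eq_iff]
  obtain ⟨hinj, hsurj⟩ := remoteness_cast_bijective hm hn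
  constructor
  · choose p hp using fun k : ZMod (m ^ n) => hsurj (k + n)
    have hstep : ∀ k, ∃ c, p k = shift c (p (k + 1)) := fun k => by
      obtain ⟨c, hc⟩ := exists_remoteness_shift_add_one hm hn (p (k + 1))
      refine ⟨c, hinj ?_⟩
      have h := hc.trans (hp (k + 1))
      have := hp k
      simp only at this ⊢
      rw [this]
      linear_combination -h
    have hentry : ∀ i (hi : i < n) k, p (k + (i : ℕ)) ⟨0, hn⟩ = p k ⟨i, hi⟩ := by
      intro i
      induction i with
      | zero => simp
      | succ i ih =>
        intro hi k
        obtain ⟨c, hc⟩ := hstep k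
        have h1 : p k ⟨i + 1, hi⟩ = p (k + 1) ⟨i, by omega⟩ := by
          rw [hc]
          simp [shift]
        rw [h1, ← ih, Nat.cast_succ, add_right_comm, add_assoc]
    refine ⟨fun k => p k ⟨0, hn⟩, fun k x => ?_⟩
    have hwin : window m n (fun k => p k ⟨0, hn⟩) k = p k :=
      funext fun i => hentry i i.isLt k
    rw [hwin]
    exact ⟨fun h => h ▸ hp k, fun h => hinj ((hp k).trans h.symm)⟩
  · intro w hw
    refine ⟨fun k l h => ?_, fun x => ?_⟩
    · have h1 := (hw k _).1 rfl
      rw [(hw l _).1 h.symm] at h1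
      exact (add_right_cancel h1).symm
    · exact ⟨remoteness m n hm hn x - n, (hw _ x).2 (by ring)⟩
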